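/- Let U ⊆ ℝⁿ be open, p₀ ∈ U, let X₁,…,X_r be linearly independent real-valued smooth vector fields on U, and let 𝒟 be the C^∞(U)-module of smooth vector fields generated by X₁,…,X_r. If f is a germ of a real-valued smooth function at p₀ with f ≥ 0 on a neighborhood of p₀, then ν_𝒟(f)(p₀) is either an even number or infinite. -/

import Mathlib

open Topology

/-- ℝⁿ as a Pi type. -/
abbrev Rn (n : ℕ) := Fin n → ℝ

/-- The action of a vector field `Y` on a function `f` : `(Y f)(x) = df_x(Y(x))`. -/
noncomputable def vfApply {n : ℕ} {E : Type*} [NormedAddCommGroup E] [NormedSpace ℝ E]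
    (Y : Rn n → Rn n) (f : Rn n → E) : Rn n → E :=
  fun x => fderiv ℝ f x (Y x)

/-- `Y` belongs to the `C^∞(U)`-module `𝒟` of vector fields generated by `X₁, …, X_r`. -/
def InModule {n r : ℕ} (U : Set (Rn n)) (X : Fin r → Rn n → Rn n) (Y : Rn n → Rn n) : Prop :=
  ∃ a : Fin r → Rn n → ℝ, (∀ j, ContDiffOn ℝ (⊤ : ℕ∞) (a j) U) ∧
    ∀ x ∈ U, Y x = ∑ j, a j x • X j x

/-- The vanishing order `ν_𝒟(f)(p)`: the smallest `m` such that some iterated derivative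
`Y_m(⋯(Y_1 f)⋯)(p) ≠ 0` with all `Y_i ∈ 𝒟`; `⊤` if no such `m` exists. -/
noncomputable def vanishOrder {n r : ℕ} {E : Type*} [NormedAddCommGroup E] [NormedSpace ℝ E]
    (U : Set (Rn n)) (X : Fin r → Rn n → Rn n) (f : Rn n → E) (p : Rn n) : ℕ∞ :=
  sInf {m : ℕ∞ | ∃ Ys : List (Rn n → Rn n), (Ys.length : ℕ∞) = m ∧
    (∀ Y ∈ Ys, InModule U X Y) ∧ (Ys.foldl (fun g Y => vfApply Y g) f) p ≠ 0}

open Asymptotics Filter Metric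

section Flow

variable {n : ℕ} {U : Set (Rn n)} {Y : Rn n → Rn n} {p : Rn n}

/-- A `C¹` vector field has a local flow that is continuous at the base point. -/
lemma exists_local_flow (hY : ContDiffAt ℝ 1 Y p) :
    ∃ φ : Rn n × ℝ → Rn n, Tendsto φ (𝓝 (p, 0)) (𝓝 p) ∧
      ∀ᶠ z in 𝓝 (p, (0 : ℝ)), φ (z.1, 0) = z.1 ∧
        HasDerivAt (fun t => φ (z.1, t)) (Y (φ z)) z.2 := by
  obtain ⟨ε, hε, a, r, L, K, hr, hPL⟩ := IsPicardLindelof.of_contDiffAt_one hY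
  obtain ⟨φ, hφ, hcont⟩ :=
    (hPL 0).exists_forall_mem_closedBall_eq_hasDerivWithinAt_continuousOn
  have hr' : (0 : ℝ) < r := by exact_mod_cast hr
  have hball : closedBall p (r : ℝ) ∈ 𝓝 p := closedBall_mem_nhds p hr'
  have hIcc : Set.Icc (0 - ε) (0 + ε) ∈ 𝓝 (0 : ℝ) := Icc_mem_nhds (by linarith) (by linarith)
  have hp : φ (p, 0) = p := (hφ p (mem_of_mem_nhds hball)).1
  refine ⟨φ, ?_, ?_⟩
  · have h := (hcont.continuousAt (prod_mem_nhds hball hIcc)).tendsto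
    rwa [hp] at h
  · have hIoo : Set.Ioo (0 - ε) (0 + ε) ∈ 𝓝 (0 : ℝ) := Ioo_mem_nhds (by linarith) (by linarith)
    filter_upwards [prod_mem_nhds hball hIoo] with z hz
    exact ⟨(hφ z.1 hz.1).1, ((hφ z.1 hz.1).2 z.2 (Set.Ioo_subset_Icc_self hz.2)).hasDerivAt
      (Icc_mem_nhds hz.2.1 hz.2.2)⟩

lemma contDiffOn_vfApply (hU : IsOpen U) (hY : ContDiffOn ℝ (⊤ : ℕ∞) Y U) {g : Rn n → ℝ}
    (hg : ContDiffOn ℝ (⊤ : ℕ∞) g U) : ContDiffOn ℝ (⊤ : ℕ∞) (vfApply Y g) U :=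
  (hg.fderiv_of_isOpen hU (m := (⊤ : ℕ∞)) (by simp)).clm_apply hY

lemma contDiffOn_iterate_vfApply (hU : IsOpen U) (hY : ContDiffOn ℝ (⊤ : ℕ∞) Y U)
    {g : Rn n → ℝ} (hg : ContDiffOn ℝ (⊤ : ℕ∞) g U) (k : ℕ) :
    ContDiffOn ℝ (⊤ : ℕ∞) ((vfApply Y)^[k] g) U := by
  induction k generalizing g with
  | zero => exact hg
  | succ k ih => exact ih (contDiffOn_vfApply hU hY hg)

lemma hasDerivAt_sum_pow_div_factorial (A : ℕ → ℝ) (j : ℕ) (t : ℝ) :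
    HasDerivAt (fun t : ℝ => ∑ k ∈ Finset.range (j + 1), t ^ k / k.factorial * A k)
      (∑ k ∈ Finset.range j, t ^ k / k.factorial * A (k + 1)) t := by
  simp_rw [Finset.sum_range_succ' _ j, pow_zero]
  refine HasDerivAt.add_const _ (HasDerivAt.fun_sum fun k _ => ?_)
  refine (((hasDerivAt_pow (k + 1) t).div_const ((k + 1).factorial : ℝ)).mul_const
    (A (k + 1))).congr_deriv ?_
  rw [Nat.factorial_succ]
  push_cast
  have : (k.factorial : ℝ) ≠ 0 := by positivity
  field_simp

/-- Taylor expansion of a function along a local flow, uniformly in the initial point. -/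
lemma isBigO_comp_flow_sub_taylor (hU : IsOpen U) (hp : p ∈ U)
    (hY : ContDiffOn ℝ (⊤ : ℕ∞) Y U) {φ : Rn n × ℝ → Rn n}
    (hlim : Tendsto φ (𝓝 (p, 0)) (𝓝 p))
    (hφ : ∀ᶠ z in 𝓝 (p, (0 : ℝ)), φ (z.1, 0) = z.1 ∧
      HasDerivAt (fun t => φ (z.1, t)) (Y (φ z)) z.2)
    (j : ℕ) {g : Rn n → ℝ} (hg : ContDiffOn ℝ (⊤ : ℕ∞) g U) :
    (fun z : Rn n × ℝ => g (φ z) -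
        ∑ k ∈ Finset.range j, z.2 ^ k / k.factorial * (vfApply Y)^[k] g z.1)
      =O[𝓝 (p, 0)] fun z => z.2 ^ j := by
  induction j generalizing g with
  | zero =>
    have hgp : ContinuousAt g p := hg.continuousOn.continuousAt (hU.mem_nhds hp)
    simpa using (hgp.tendsto.comp hlim).isBigO_one ℝ
  | succ j ih =>
    obtain ⟨C, hC, hbound⟩ := (ih (contDiffOn_vfApply hU hY hg)).exists_nonneg
    have hev := hφ.and (hbound.bound.and (hlim.eventually (hU.mem_nhds hp)))
    obtain ⟨δ, hδ, hball⟩ := Metric.eventually_nhds_iff_ball.1 hev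
    refine IsBigO.of_bound C (Metric.eventually_nhds_iff_ball.2 ⟨δ, hδ, ?_⟩)
    rintro ⟨x, t⟩ hz
    rw [← ball_prod_same] at hz
    obtain ⟨hx, ht⟩ := hz
    have hz (s : ℝ) (hs : s ∈ closedBall (0 : ℝ) ‖t‖) : ((x, s) : Rn n × ℝ) ∈ ball (p, 0) δ := by
      rw [← ball_prod_same]
      simp only [mem_closedBall_zero_iff, mem_ball_zero_iff] at hs ht
      exact ⟨hx, by simpa using hs.trans_lt ht⟩
    have hderiv (s : ℝ) (hs : s ∈ closedBall (0 : ℝ) ‖t‖) :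
        HasDerivWithinAt (fun s => g (φ (x, s)) -
            ∑ k ∈ Finset.range (j + 1), s ^ k / k.factorial * (vfApply Y)^[k] g x)
          (vfApply Y g (φ (x, s)) -
            ∑ k ∈ Finset.range j, s ^ k / k.factorial * (vfApply Y)^[k] (vfApply Y g) x)
          (closedBall 0 ‖t‖) s := by
      obtain ⟨⟨-, hd⟩, -, hmem⟩ := hball _ (hz s hs)
      have hgd : HasFDerivAt g (fderiv ℝ g (φ (x, s))) (φ (x, s)) :=
        ((hg.contDiffAt (hU.mem_nhds hmem)).differentiableAt (by simp)).hasFDerivAt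
      exact ((hgd.comp_hasDerivAt s hd).sub
        (hasDerivAt_sum_pow_div_factorial (fun k => (vfApply Y)^[k] g x) j s)).hasDerivWithinAt
    have hle (s : ℝ) (hs : s ∈ closedBall (0 : ℝ) ‖t‖) :
        ‖vfApply Y g (φ (x, s)) -
          ∑ k ∈ Finset.range j, s ^ k / k.factorial * (vfApply Y)^[k] (vfApply Y g) x‖
        ≤ C * ‖t‖ ^ j := by
      refine (hball _ (hz s hs)).2.1.trans ?_
      rw [norm_pow]
      gcongr
      simpa using hs
    have hmv := (convex_closedBall (0 : ℝ) ‖t‖).norm_image_sub_le_of_norm_hasDerivWithin_le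
      hderiv hle (mem_closedBall_self (norm_nonneg t)) (by simp : t ∈ closedBall (0 : ℝ) ‖t‖)
    have h0 : φ (x, 0) = x := (hball _ (hz 0 (mem_closedBall_self (norm_nonneg t)))).1.1
    simpa [h0, Finset.sum_range_succ', norm_pow, pow_succ, mul_assoc] using hmv

end Flow

section Order

variable {n r : ℕ} {U : Set (Rn n)} {X : Fin r → Rn n → Rn n} {p : Rn n}

lemma InModule.contDiffOn {Y : Rn n → Rn n} (hX : ∀ j, ContDiffOn ℝ (⊤ : ℕ∞) (X j) U)
    (hY : InModule U X Y) : ContDiffOn ℝ (⊤ : ℕ∞) Y U := by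
  obtain ⟨a, ha, hYa⟩ := hY
  exact (ContDiffOn.sum fun j _ => (ha j).smul (hX j)).congr hYa

/-- All iterated derivatives of `g` along fewer than `j` fields of the module vanish at `p`. -/
def VanishesBelow (U : Set (Rn n)) (X : Fin r → Rn n → Rn n) (p : Rn n) (j : ℕ)
    (g : Rn n → ℝ) : Prop :=
  ∀ Ys : List (Rn n → Rn n), (∀ Y ∈ Ys, InModule U X Y) → Ys.length < j →
    (Ys.foldl (fun g Y => vfApply Y g) g) p = 0

lemma VanishesBelow.vfApply {j : ℕ} {g : Rn n → ℝ} {Y : Rn n → Rn n}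
    (hg : VanishesBelow U X p (j + 1) g) (hY : InModule U X Y) :
    VanishesBelow U X p j (vfApply Y g) := fun Ys hYs hlen =>
  hg (Y :: Ys) (List.forall_mem_cons.2 ⟨hY, hYs⟩) (by simpa using hlen)

lemma VanishesBelow.iterate_vfApply {j k : ℕ} {g : Rn n → ℝ} {Y : Rn n → Rn n}
    (hg : VanishesBelow U X p (j + k) g) (hY : InModule U X Y) :
    VanishesBelow U X p j ((_root_.vfApply Y)^[k] g) := by
  induction k generalizing g with
  | zero => exact hg
  | succ k ih => exact ih (VanishesBelow.vfApply hg hY)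

/-- The coefficient of `s ^ j` in the expansion of `g` at the point reached from `p` by following,
for each `(c, Y)` in the list (last entry first), the flow of `Y` for time `c * s`. -/
noncomputable def flowCoeff (p : Rn n) : List (ℝ × (Rn n → Rn n)) → ℕ → (Rn n → ℝ) → ℝ
  | [], j, g => if j = 0 then g p else 0
  | cY :: L, j, g => ∑ k ∈ Finset.range (j + 1),
      cY.1 ^ k / k.factorial * flowCoeff p L (j - k) ((vfApply cY.2)^[k] g)

/-- Concatenating flows of fields in the module yields a path along which every smooth function
that vanishes below order `j` is `flowCoeff p L j g * s ^ j + O(s ^ (j + 1))`. -/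
lemma exists_path_isBigO (hU : IsOpen U) (hp : p ∈ U)
    (hX : ∀ j, ContDiffOn ℝ (⊤ : ℕ∞) (X j) U) (L : List (ℝ × (Rn n → Rn n)))
    (hL : ∀ cY ∈ L, InModule U X cY.2) :
    ∃ γ : ℝ → Rn n, Tendsto γ (𝓝 0) (𝓝 p) ∧
      ∀ (j : ℕ) (g : Rn n → ℝ), ContDiffOn ℝ (⊤ : ℕ∞) g U → VanishesBelow U X p j g →
        (fun s => g (γ s) - s ^ j * flowCoeff p L j g) =O[𝓝 0] fun s : ℝ => s ^ (j + 1) := by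
  induction L with
  | nil =>
    refine ⟨fun _ => p, tendsto_const_nhds, fun j g _ hv => ?_⟩
    rcases Nat.eq_zero_or_pos j with rfl | hj
    · simpa [flowCoeff] using isBigO_zero _ _
    · have : g p = 0 := hv [] (by simp) hj
      simpa [flowCoeff, hj.ne', this] using isBigO_zero _ _
  | cons cY L ih =>
    obtain ⟨c, Y⟩ := cY
    obtain ⟨hYmod, hL⟩ := List.forall_mem_cons.1 hL
    obtain ⟨γ, hγ, hexp⟩ := ih hL
    have hY : ContDiffOn ℝ (⊤ : ℕ∞) Y U := InModule.contDiffOn hX hYmod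
    obtain ⟨φ, hlim, hφ⟩ :=
      exists_local_flow ((hY.contDiffAt (hU.mem_nhds hp)).of_le (by exact_mod_cast le_top))
    have hpath : Tendsto (fun s : ℝ => (γ s, c * s)) (𝓝 0) (𝓝 (p, 0)) := by
      refine hγ.prodMk_nhds ?_
      simpa using (continuous_const_mul c).tendsto (0 : ℝ)
    refine ⟨fun s => φ (γ s, c * s), hlim.comp hpath, fun j g hg hv => ?_⟩
    have htaylor : (fun s : ℝ => g (φ (γ s, c * s)) - ∑ k ∈ Finset.range (j + 1),
        (c * s) ^ k / k.factorial * (vfApply Y)^[k] g (γ s)) =O[𝓝 0] fun s => s ^ (j + 1) := by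
      refine ((isBigO_comp_flow_sub_taylor hU hp hY hlim hφ (j + 1) hg).comp_tendsto
        hpath).trans ?_
      simp only [Function.comp_def, mul_pow]
      exact isBigO_const_mul_self _ _ _
    have hsum : (fun s : ℝ => ∑ k ∈ Finset.range (j + 1), (c * s) ^ k / k.factorial *
        ((vfApply Y)^[k] g (γ s) - s ^ (j - k) * flowCoeff p L (j - k) ((vfApply Y)^[k] g)))
        =O[𝓝 0] fun s => s ^ (j + 1) := by
      refine IsBigO.fun_sum fun k hk => ?_
      have hkj : k ≤ j := Nat.lt_succ_iff.1 (Finset.mem_range.1 hk)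
      have hv' : VanishesBelow U X p (j - k) ((vfApply Y)^[k] g) :=
        VanishesBelow.iterate_vfApply (by rwa [Nat.sub_add_cancel hkj]) hYmod
      have h1 : (fun s : ℝ => (c * s) ^ k / k.factorial) =O[𝓝 0] fun s => s ^ k := by
        refine (isBigO_const_mul_self (c ^ k / k.factorial : ℝ) (fun s : ℝ => s ^ k)
          (𝓝 0)).congr_left fun s => ?_
        ring
      refine (h1.mul (hexp (j - k) _ (contDiffOn_iterate_vfApply hU hY hg k) hv')).congr_right
        fun s => ?_
      rw [← pow_add]
      congr 1
      omega
    refine (htaylor.add hsum).congr_left fun s => ?_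
    have hcoeff : s ^ j * flowCoeff p ((c, Y) :: L) j g = ∑ k ∈ Finset.range (j + 1),
        (c * s) ^ k / k.factorial *
          (s ^ (j - k) * flowCoeff p L (j - k) ((vfApply Y)^[k] g)) := by
      rw [flowCoeff, Finset.mul_sum]
      refine Finset.sum_congr rfl fun k hk => ?_
      have hkj : k ≤ j := Nat.lt_succ_iff.1 (Finset.mem_range.1 hk)
      rw [← Nat.add_sub_cancel' hkj, pow_add, Nat.add_sub_cancel_left]
      ring
    rw [hcoeff]
    simp only [mul_sub, Finset.sum_sub_distrib]
    ring

/-- If `s ^ j * A` has a nonnegative perturbation of order `s ^ (j + 1)` and `j` is odd,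
then `A = 0`. -/
lemma eq_zero_of_odd_of_isBigO {h : ℝ → ℝ} {A : ℝ} {j : ℕ} (hj : Odd j)
    (hpos : ∀ᶠ s in 𝓝 (0 : ℝ), 0 ≤ h s)
    (hO : (fun s => h s - s ^ j * A) =O[𝓝 0] fun s : ℝ => s ^ (j + 1)) : A = 0 := by
  have hlim : Tendsto (fun s => h s / s ^ j) (𝓝[≠] 0) (𝓝 A) := by
    have ho : (fun s => h s - s ^ j * A) =o[𝓝 0] fun s : ℝ => s ^ j :=
      hO.trans_isLittleO (isLittleO_pow_pow (Nat.lt_succ_self j))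
    have := ((ho.mono nhdsWithin_le_nhds).tendsto_div_nhds_zero (l := 𝓝[≠] 0)).add_const A
    rw [zero_add] at this
    refine this.congr' ?_
    filter_upwards [self_mem_nhdsWithin] with s hs
    have : s ^ j ≠ 0 := pow_ne_zero _ hs
    field_simp
    ring
  refine le_antisymm ?_ ?_
  · refine le_of_tendsto (hlim.mono_left (nhdsLT_le_nhdsNE 0)) ?_
    filter_upwards [self_mem_nhdsWithin, hpos.filter_mono nhdsWithin_le_nhds] with s hs h0
    exact div_nonpos_of_nonneg_of_nonpos h0 (hj.pow_nonpos (le_of_lt hs))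
  · refine ge_of_tendsto (hlim.mono_left (nhdsGT_le_nhdsNE 0)) ?_
    filter_upwards [self_mem_nhdsWithin, hpos.filter_mono nhdsWithin_le_nhds] with s hs h0
    exact div_nonneg h0 (pow_nonneg (le_of_lt hs) _)

lemma coeff_eq_zero_of_forall_sum_eq_zero {N : ℕ} {a : ℕ → ℝ}
    (h : ∀ c : ℝ, ∑ k ∈ Finset.range N, c ^ k * a k = 0) {k : ℕ} (hk : k < N) : a k = 0 := by
  have hP : ∑ k ∈ Finset.range N, Polynomial.C (a k) * Polynomial.X ^ k = 0 :=
    Polynomial.funext fun c => by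
      simpa only [Polynomial.eval_finsetSum, Polynomial.eval_mul, Polynomial.eval_C,
        Polynomial.eval_pow, Polynomial.eval_X, Polynomial.eval_zero, mul_comm (a _)] using h c
  have := congrArg (fun P => Polynomial.coeff P k) hP
  simpa [Polynomial.finsetSum_coeff, Polynomial.coeff_C_mul, Polynomial.coeff_X_pow, hk]
    using this

/-- The coefficients `flowCoeff` determine the iterated derivatives. -/
lemma foldl_vfApply_eq_zero (Ys : List (Rn n → Rn n)) (hYs : ∀ Y ∈ Ys, InModule U X Y)
    (g : Rn n → ℝ)
    (hg : ∀ L : List (ℝ × (Rn n → Rn n)), (∀ cY ∈ L, InModule U X cY.2) →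
      flowCoeff p L Ys.length g = 0) :
    (Ys.foldl (fun g Y => vfApply Y g) g) p = 0 := by
  induction Ys generalizing g with
  | nil => simpa [flowCoeff] using hg [] (by simp)
  | cons Y Ys ih =>
    obtain ⟨hY, hYs⟩ := List.forall_mem_cons.1 hYs
    refine ih hYs _ fun L hL => ?_
    have hsum (c : ℝ) : ∑ k ∈ Finset.range (Ys.length + 1 + 1), c ^ k *
        (flowCoeff p L (Ys.length + 1 - k) ((vfApply Y)^[k] g) / k.factorial) = 0 := by
      rw [← hg ((c, Y) :: L) (List.forall_mem_cons.2 ⟨hY, hL⟩), List.length_cons, flowCoeff]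
      exact Finset.sum_congr rfl fun k _ => by ring
    simpa using coeff_eq_zero_of_forall_sum_eq_zero hsum (k := 1) (by omega)

end Order

/-- If `f` is a germ of a real-valued smooth function at `p₀` with `f ≥ 0`
on a neighborhood of `p₀`, then `ν_𝒟(f)(p₀)` is an even number or infinite. -/
theorem vanishOrder_even {n r : ℕ} (U : Set (Rn n)) (hU : IsOpen U) (p₀ : Rn n) (hp₀ : p₀ ∈ U)
    (X : Fin r → Rn n → Rn n) (hX : ∀ j, ContDiffOn ℝ (⊤ : ℕ∞) (X j) U)
    (hind : ∀ x ∈ U, LinearIndependent ℝ (fun j => X j x))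
    (f : Rn n → ℝ) (hf : ContDiffOn ℝ (⊤ : ℕ∞) f U)
    (hpos : ∀ᶠ x in 𝓝 p₀, 0 ≤ f x) :
    (∃ k : ℕ, vanishOrder U X f p₀ = 2 * (k : ℕ∞)) ∨ vanishOrder U X f p₀ = ⊤ := by
  rw [or_iff_not_imp_right]
  intro htop
  have hne : {m : ℕ∞ | ∃ Ys : List (Rn n → Rn n), (Ys.length : ℕ∞) = m ∧
      (∀ Y ∈ Ys, InModule U X Y) ∧ (Ys.foldl (fun g Y => vfApply Y g) f) p₀ ≠ 0}.Nonempty := by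
    by_contra hempty
    rw [Set.not_nonempty_iff_eq_empty] at hempty
    exact htop (by rw [vanishOrder, hempty, sInf_empty])
  obtain ⟨Ys, hlen, hYs, hY0⟩ := csInf_mem hne
  change (Ys.length : ℕ∞) = vanishOrder U X f p₀ at hlen
  rcases Nat.even_or_odd Ys.length with ⟨k, hk⟩ | hodd
  · refine ⟨k, ?_⟩
    rw [← hlen, hk, Nat.cast_add, two_mul]
  · refine absurd (foldl_vfApply_eq_zero Ys hYs f fun L hL => ?_) hY0
    have hvan : VanishesBelow U X p₀ Ys.length f := by
      intro Zs hZs hlt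
      by_contra hZ0
      have hle : vanishOrder U X f p₀ ≤ (Zs.length : ℕ∞) := sInf_le ⟨Zs, rfl, hZs, hZ0⟩
      rw [← hlen, Nat.cast_le] at hle
      omega
    obtain ⟨γ, hγ, hexp⟩ := exists_path_isBigO hU hp₀ hX L hL
    exact eq_zero_of_odd_of_isBigO hodd (hγ.eventually hpos) (hexp _ f hf hvan)
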